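/- arXiv:1804.03322 — 9 statements merged into one kernel-verified Lean document; each statement's English description precedes it below -/
import Mathlib

section
/- Let M be a commutative monoid acting injectively on a set X, let G be the Grothendieck group of M, and let H be a subgroup of G. Then for every g ∈ H and every H-invertible element x ∈ X: (i) the element x_g ∈ X satisfying m·x = m'·x_g for every representative (m,m') of g is unique; (ii) x_g is itself H-invertible; and (iii) defining g·x := x_g, one has h·(g·x) = (hg)·x for all h, g ∈ H. Hence (g,x) ↦ x_g is a well-defined action of the group H on the set X_H of H-invertible elements. -/
/-!
Grothendieck group of a commutative monoid, monoid actions, H-invertible elements,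
and the induced action of a subgroup of the Grothendieck group.
-/

namespace AbelianNetworks

variable (M : Type*) [CommMonoid M]

/-- The defining relation of the Grothendieck group of a commutative monoid:
`(m₁, m₁') ∼ (m₂, m₂')` iff there is `m` with `m * m₁ * m₂' = m * m₁' * m₂`. -/
instance grothSetoid : Setoid (M × M) where
  r p q := ∃ m : M, m * p.1 * q.2 = m * p.2 * q.1
  iseqv := by
    refine ⟨fun p => ⟨1, ?_⟩, ?_, ?_⟩
    · simp only [mul_assoc, mul_comm, mul_left_comm]
    · rintro p q ⟨m, hm⟩
      refine ⟨m, ?_⟩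
      calc m * q.1 * p.2 = m * p.2 * q.1 := by
            simp only [mul_assoc, mul_comm, mul_left_comm]
        _ = m * p.1 * q.2 := hm.symm
        _ = m * q.2 * p.1 := by
            simp only [mul_assoc, mul_comm, mul_left_comm]
    · rintro p q r ⟨m, hm⟩ ⟨n, hn⟩
      refine ⟨m * n * q.2, ?_⟩
      calc m * n * q.2 * p.1 * r.2
          = m * p.1 * q.2 * (n * r.2) := by
            simp only [mul_assoc, mul_comm, mul_left_comm]
        _ = m * p.2 * q.1 * (n * r.2) := by rw [hm]
        _ = n * q.1 * r.2 * (m * p.2) := by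
            simp only [mul_assoc, mul_comm, mul_left_comm]
        _ = n * q.2 * r.1 * (m * p.2) := by rw [hn]
        _ = m * n * q.2 * p.2 * r.1 := by
            simp only [mul_assoc, mul_comm, mul_left_comm]

/-- The Grothendieck group of the commutative monoid `M`, as the quotient of `M × M`
by the relation above. -/
def Groth := Quotient (grothSetoid M)

/-- The class of the pair `(m, m')` in the Grothendieck group; `(m, m')` is called a
*representative* of this class. -/
def Groth.mk (m m' : M) : Groth M := Quotient.mk (grothSetoid M) (m, m')

instance : One (Groth M) := ⟨Groth.mk M 1 1⟩

instance : Mul (Groth M) :=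
  ⟨Quotient.map₂ (fun p q => (p.1 * q.1, p.2 * q.2)) (by
    rintro ⟨a, a'⟩ ⟨b, b'⟩ ⟨m, hm⟩ ⟨c, c'⟩ ⟨d, d'⟩ ⟨n, hn⟩
    refine ⟨m * n, ?_⟩
    calc m * n * (a * c) * (b' * d')
        = m * a * b' * (n * c * d') := by
          simp only [mul_assoc, mul_comm, mul_left_comm]
      _ = m * a' * b * (n * c' * d) := by rw [hm, hn]
      _ = m * n * (a' * c') * (b * d) := by
          simp only [mul_assoc, mul_comm, mul_left_comm])⟩

instance : Inv (Groth M) :=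
  ⟨Quotient.map (fun p => (p.2, p.1)) (by
    rintro ⟨a, a'⟩ ⟨b, b'⟩ ⟨m, hm⟩
    exact ⟨m, hm.symm⟩)⟩

/-- The Grothendieck group of a commutative monoid is an abelian group. -/
instance : CommGroup (Groth M) where
  mul_assoc := by
    rintro ⟨⟨a, a'⟩⟩ ⟨⟨b, b'⟩⟩ ⟨⟨c, c'⟩⟩
    exact Quotient.sound ⟨1, by simp only [one_mul, mul_one, mul_assoc, mul_comm, mul_left_comm]⟩
  one_mul := by
    rintro ⟨⟨a, a'⟩⟩
    exact Quotient.sound ⟨1, by simp only [one_mul, mul_one, mul_assoc, mul_comm, mul_left_comm]⟩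
  mul_one := by
    rintro ⟨⟨a, a'⟩⟩
    exact Quotient.sound ⟨1, by simp only [one_mul, mul_one, mul_assoc, mul_comm, mul_left_comm]⟩
  inv_mul_cancel := by
    rintro ⟨⟨a, a'⟩⟩
    exact Quotient.sound ⟨1, by simp only [one_mul, mul_one, mul_assoc, mul_comm, mul_left_comm]⟩
  mul_comm := by
    rintro ⟨⟨a, a'⟩⟩ ⟨⟨b, b'⟩⟩
    exact Quotient.sound ⟨1, by simp only [one_mul, mul_one, mul_assoc, mul_comm, mul_left_comm]⟩

variable {M}
variable {X : Type*} [MulAction M X]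

/-- `ActsTo g x y` says that `y` is a value of `g · x`: for every representative `(m, m')`
of `g` one has `m • x = m' • y`. -/
def ActsTo (g : Groth M) (x y : X) : Prop :=
  ∀ m m' : M, g = Groth.mk M m m' → m • x = m' • y

/-- An element `x ∈ X` is `H`-invertible if for every `g ∈ H` there is `x_g ∈ X` with
`m • x = m' • x_g` for every representative `(m, m')` of `g`. -/
def IsInvertibleUnder (H : Subgroup (Groth M)) (x : X) : Prop :=
  ∀ g ∈ H, ∃ y : X, ActsTo g x y

theorem Groth.mk_mul_mk (m m' n n' : M) :
    Groth.mk M m m' * Groth.mk M n n' = Groth.mk M (m * n) (m' * n') :=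
  rfl

theorem Groth.exists_eq_mk (g : Groth M) : ∃ m m' : M, g = Groth.mk M m m' := by
  obtain ⟨⟨m, m'⟩⟩ := g
  exact ⟨m, m', rfl⟩

/-- For an injective action, a single representative suffices to test `ActsTo`. -/
theorem actsTo_mk_iff (hinj : ∀ (m : M) (x x' : X), m • x = m • x' → x = x')
    (m m' : M) (x y : X) : ActsTo (Groth.mk M m m') x y ↔ m • x = m' • y := by
  refine ⟨fun h => h m m' rfl, fun h a a' hrep => ?_⟩
  obtain ⟨k, hk⟩ : ∃ k : M, k * m * a' = k * m' * a := Quotient.exact hrep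
  apply hinj (k * m')
  calc (k * m') • a • x = (k * m * a') • x := by rw [hk, mul_smul (k * m') a]
    _ = (k * a') • m • x := by rw [mul_right_comm, mul_smul (k * a')]
    _ = (k * a') • m' • y := by rw [h]
    _ = (k * m') • a' • y := by rw [← mul_smul, ← mul_smul, mul_right_comm]

/-- If `y = g • x`, then `(h * g) • x = w` is equivalent to `h • y = w`. -/
theorem ActsTo.mul_iff (hinj : ∀ (m : M) (x x' : X), m • x = m • x' → x = x')
    {g : Groth M} {x y : X} (hg : ActsTo g x y) (h : Groth M) (w : X) :
    ActsTo (h * g) x w ↔ ActsTo h y w := by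
  obtain ⟨m, m', rfl⟩ := g.exists_eq_mk
  obtain ⟨n, n', rfl⟩ := h.exists_eq_mk
  rw [actsTo_mk_iff hinj] at hg
  rw [Groth.mk_mul_mk, actsTo_mk_iff hinj, actsTo_mk_iff hinj, mul_smul, hg,
    smul_comm n m', mul_comm n' m', mul_smul]
  exact ⟨hinj m' _ _, fun e => by rw [e]⟩

/-- For an injective action, the value of `g • x` is unique. -/
theorem ActsTo.unique (hinj : ∀ (m : M) (x x' : X), m • x = m • x' → x = x')
    {g : Groth M} {x y₁ y₂ : X} (h₁ : ActsTo g x y₁) (h₂ : ActsTo g x y₂) : y₁ = y₂ := by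
  obtain ⟨m, m', rfl⟩ := g.exists_eq_mk
  exact hinj m' _ _ ((h₁ m m' rfl).symm.trans (h₂ m m' rfl))

/-- Let `M` be a commutative monoid acting injectively on a set `X`, let `G` be the
Grothendieck group of `M`, and let `H` be a subgroup of `G`. Then for every `g ∈ H` and
every `H`-invertible `x ∈ X`: (i) the element `x_g` with `m • x = m' • x_g` for all
representatives `(m, m')` of `g` is unique; (ii) `x_g` is itself `H`-invertible;
(iii) setting `g • x := x_g`, one has `h • (g • x) = (h * g) • x` for all `h, g ∈ H`.
Hence `(g, x) ↦ x_g` is a well-defined action of `H` on the set of `H`-invertible elements. -/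
theorem torsion_action_well_defined
    (hinj : ∀ (m : M) (x x' : X), m • x = m • x' → x = x')
    (H : Subgroup (Groth M)) :
    (∀ g ∈ H, ∀ x : X, IsInvertibleUnder H x →
      ∀ y₁ y₂ : X, ActsTo g x y₁ → ActsTo g x y₂ → y₁ = y₂) ∧
    (∀ g ∈ H, ∀ x : X, IsInvertibleUnder H x →
      ∀ y : X, ActsTo g x y → IsInvertibleUnder H y) ∧
    (∀ g ∈ H, ∀ h ∈ H, ∀ x y z w : X, IsInvertibleUnder H x →
      ActsTo g x y → ActsTo h y z → ActsTo (h * g) x w → z = w) := by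
  refine ⟨fun _ _ _ _ _ _ h₁ h₂ => h₁.unique hinj h₂, fun g hg x hx y hy h hh => ?_,
    fun g _ h _ x y z w _ hy hz hw => hz.unique hinj ((hy.mul_iff hinj h w).1 hw)⟩
  obtain ⟨w, hw⟩ := hx (h * g) (H.mul_mem hh hg)
  exact ⟨w, (hy.mul_iff hinj h w).1 hw⟩

end AbelianNetworks
end

section
/- Let M be a commutative monoid acting injectively on a set X, let G be the Grothendieck group of M, and let H be a subgroup of G. If the action of M on X is free, then the induced action of H on X_H (given by g·x = x_g) is free: for g1, g2 ∈ H and x ∈ X_H, g1·x = g2·x implies g1 = g2. -/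
/-!
Grothendieck group of a commutative monoid, monoid actions, H-invertible elements,
and the induced action of a subgroup of the Grothendieck group.
-/

namespace AbelianNetworks

variable (M : Type*) [CommMonoid M]

variable {M}
variable {X : Type*} [MulAction M X]

/-- Let `M` be a commutative monoid acting injectively on a set `X`, let `G` be the
Grothendieck group of `M`, and `H` a subgroup of `G`. If the action of `M` on `X` is free,
then the induced action of `H` on the set of `H`-invertible elements is free:
`g₁ • x = g₂ • x` implies `g₁ = g₂`. -/
theorem induced_action_free
    (hinj : ∀ (m : M) (x x' : X), m • x = m • x' → x = x')
    (hfree : ∀ (m m' : M) (x : X), m • x = m' • x → m = m')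
    (H : Subgroup (Groth M)) :
    ∀ g₁ ∈ H, ∀ g₂ ∈ H, ∀ x y : X, IsInvertibleUnder H x →
      ActsTo g₁ x y → ActsTo g₂ x y → g₁ = g₂ := by
  rintro ⟨⟨a, a'⟩⟩ - ⟨⟨b, b'⟩⟩ - x y - h₁ h₂
  have ha : a • x = a' • y := h₁ a a' rfl
  have hb : b • x = b' • y := h₂ b b' rfl
  have key : a * b' = a' * b := by
    apply hfree _ _ y
    rw [mul_smul, ← hb, mul_comm a' b, mul_smul, ← ha, smul_smul, smul_smul, mul_comm]
  exact Quotient.sound ⟨1, by simpa only [one_mul] using key⟩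

end AbelianNetworks
end

section
/- Let M be a commutative monoid acting injectively on a set X, let G be the Grothendieck group of M, and let H be a subgroup of G. If H is finite and X is nonempty, then the set X_H of H-invertible elements of X is nonempty. -/
/-!
Grothendieck group of a commutative monoid, monoid actions, H-invertible elements,
and the induced action of a subgroup of the Grothendieck group.
-/

namespace AbelianNetworks

variable (M : Type*) [CommMonoid M]

variable {M}
variable {X : Type*} [MulAction M X]

/-- If `(a, b)` represents `g`, then under an injective action `g` sends `b • z` to `a • z`. -/
theorem ActsTo.of_mk_smul (hinj : ∀ (m : M) (x x' : X), m • x = m • x' → x = x')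
    (a b : M) (z : X) : ActsTo (Groth.mk M a b) (b • z) (a • z) := by
  intro m m' h
  obtain ⟨n, hn⟩ : ∃ n : M, n * a * m' = n * b * m := Quotient.exact h
  apply hinj n
  have e₁ : n * (m * b) = n * b * m := by rw [mul_comm m, mul_assoc]
  have e₂ : n * (m' * a) = n * a * m' := by rw [mul_comm m', mul_assoc]
  simp only [smul_smul, e₁, e₂, hn]

/-- Let `M` be a commutative monoid acting injectively on a set `X`, let `G` be the
Grothendieck group of `M`, and `H` a subgroup of `G`. If `H` is finite and `X` is nonempty,
then the set of `H`-invertible elements of `X` is nonempty. -/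
theorem exists_invertible_of_finite
    (hinj : ∀ (m : M) (x x' : X), m • x = m • x' → x = x')
    (H : Subgroup (Groth M)) (hH : Finite H) (hX : Nonempty X) :
    ∃ x : X, IsInvertibleUnder H x := by
  have := Fintype.ofFinite H
  obtain ⟨x₀⟩ := hX
  have hrep (g : H) : ∃ p : M × M, Groth.mk M p.1 p.2 = g := Quotient.exists_rep (g : Groth M)
  choose p hp using hrep
  refine ⟨(∏ h, (p h).2) • x₀, fun g hg => ?_⟩
  obtain ⟨c, hc⟩ := Finset.dvd_prod_of_mem (fun h => (p h).2) (Finset.mem_univ (⟨g, hg⟩ : H))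
  refine ⟨(p ⟨g, hg⟩).1 • c • x₀, ?_⟩
  have h := ActsTo.of_mk_smul hinj (p ⟨g, hg⟩).1 (p ⟨g, hg⟩).2 (c • x₀)
  rwa [hp, smul_smul _ c, ← hc] at h

end AbelianNetworks
end

section
/- Let M be a finitely generated commutative monoid that acts freely and injectively on a nonempty set X, let G be its Grothendieck group and τ(G) the torsion subgroup of G. Then the set X^× of τ(G)-invertible elements of X is nonempty, τ(G) is a finite abelian group, and τ(G) acts freely on X^×. -/
/-!
Grothendieck group of a commutative monoid, monoid actions, H-invertible elements,
and the induced action of a subgroup of the Grothendieck group.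
-/

namespace AbelianNetworks

variable (M : Type*) [CommMonoid M]

variable {M}
variable {X : Type*} [MulAction M X]

theorem Groth.mk_eq_mk_iff {a a' b b' : M} :
    Groth.mk M a a' = Groth.mk M b b' ↔ ∃ m : M, m * a * b' = m * a' * b :=
  Quotient.eq (r := grothSetoid M)

theorem Groth.exists_rep (g : Groth M) : ∃ a a' : M, Groth.mk M a a' = g := by
  obtain ⟨⟨a, a'⟩, h⟩ := Quotient.exists_rep g
  exact ⟨a, a', h⟩

variable (M) in
/-- The quotient map `M × M → Groth M` as a monoid homomorphism. -/
def Groth.mkHom : M × M →* Groth M where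
  toFun p := Groth.mk M p.1 p.2
  map_one' := rfl
  map_mul' _ _ := rfl

instance [Monoid.FG M] : Group.FG (Groth M) :=
  Group.fg_iff_monoid_fg.mpr <| Monoid.fg_of_surjective (Groth.mkHom M) fun g =>
    let ⟨a, a', h⟩ := g.exists_rep
    ⟨(a, a'), h⟩

/-- Every subgroup of a finitely generated abelian group is finitely generated. -/
theorem subgroup_fg_of_commGroup_fg {G : Type*} [CommGroup G] [Group.FG G] (H : Subgroup G) :
    H.FG := by
  have : Module.Finite ℤ (Additive G) := Module.Finite.iff_addGroup_fg.mpr inferInstance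
  rw [Subgroup.fg_iff_add_fg, ← AddSubgroup.toIntSubmodule_toAddSubgroup H.toAddSubgroup]
  exact Submodule.fg_toAddSubgroup (IsNoetherian.noetherian _)

/-- The torsion subgroup of a finitely generated abelian group is finite. -/
theorem finite_torsion_of_commGroup_fg {G : Type*} [CommGroup G] [Group.FG G] :
    Finite (CommGroup.torsion G) := by
  have := (Group.fg_iff_subgroup_fg _).mpr (subgroup_fg_of_commGroup_fg (CommGroup.torsion G))
  exact CommGroup.finite_of_fg_isMulTorsion _ (CommMonoid.torsion.isMulTorsion (G := G))

/-- For an injective action, one representative `(a, a')` of `g` with `a • x = a' • y` is enough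
to conclude that `y` is a value of `g · x`. -/
theorem actsTo_of_rep (hinj : ∀ (m : M) (x x' : X), m • x = m • x' → x = x') {a a' : M} {x y : X}
    (h : a • x = a' • y) : ActsTo (Groth.mk M a a') x y := by
  intro m m' hm
  obtain ⟨n, hn⟩ := Groth.mk_eq_mk_iff.mp hm
  refine hinj (n * a') _ _ ?_
  calc (n * a') • m • x = (n * a' * m) • x := (mul_smul _ _ _).symm
    _ = (n * m') • a • x := by rw [← hn, ← mul_smul, mul_right_comm]
    _ = (n * m') • a' • y := by rw [h]
    _ = (n * a') • m' • y := by simp only [← mul_smul, mul_right_comm]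

/-- For an injective action on a nonempty set, elements invertible under a finite subgroup
exist. -/
theorem exists_isInvertibleUnder (hinj : ∀ (m : M) (x x' : X), m • x = m • x' → x = x')
    [Nonempty X] (H : Subgroup (Groth M)) [Finite H] : ∃ x : X, IsInvertibleUnder H x := by
  classical
  have := Fintype.ofFinite H
  choose a b hab using Groth.exists_rep (M := M)
  obtain ⟨x₀⟩ := ‹Nonempty X›
  refine ⟨(∏ h : H, b h) • x₀, fun g hg =>
    ⟨(a g * ∏ h ∈ Finset.univ.erase (⟨g, hg⟩ : H), b h) • x₀, ?_⟩⟩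
  have key := actsTo_of_rep (a := a g) (a' := b g) (x := (∏ h : H, b h) • x₀)
    (y := (a g * ∏ h ∈ Finset.univ.erase (⟨g, hg⟩ : H), b h) • x₀) hinj (by
      rw [← Finset.mul_prod_erase Finset.univ (fun h : H => b h) (Finset.mem_univ ⟨g, hg⟩),
        ← mul_smul, ← mul_smul, mul_left_comm])
  rwa [hab] at key

/-- For a free action, an element of the Grothendieck group is determined by any of its values. -/
theorem ActsTo.eq (hfree : ∀ (m m' : M) (x : X), m • x = m' • x → m = m') {g₁ g₂ : Groth M}
    {x y : X} (h₁ : ActsTo g₁ x y) (h₂ : ActsTo g₂ x y) : g₁ = g₂ := by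
  obtain ⟨a, a', rfl⟩ := g₁.exists_rep
  obtain ⟨b, b', rfl⟩ := g₂.exists_rep
  refine Groth.mk_eq_mk_iff.mpr ⟨1, hfree _ _ x ?_⟩
  calc (1 * a * b') • x = b' • a • x := by rw [one_mul, mul_comm, mul_smul]
    _ = b' • a' • y := by rw [h₁ a a' rfl]
    _ = a' • b' • y := by rw [← mul_smul, ← mul_smul, mul_comm]
    _ = a' • b • x := by rw [h₂ b b' rfl]
    _ = (1 * a' * b) • x := by rw [one_mul, mul_smul]

/-- Let `M` be a finitely generated commutative monoid acting freely and injectively on a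
nonempty set `X`, let `G` be its Grothendieck group and `τ(G)` the torsion subgroup of `G`.
Then the set `X^×` of `τ(G)`-invertible elements of `X` is nonempty, `τ(G)` is a finite
(abelian) group, and `τ(G)` acts freely on `X^×`. -/
theorem torsion_group_finite_and_acts_freely [Monoid.FG M]
    (hfree : ∀ (m m' : M) (x : X), m • x = m' • x → m = m')
    (hinj : ∀ (m : M) (x x' : X), m • x = m • x' → x = x')
    (hX : Nonempty X) :
    (∃ x : X, IsInvertibleUnder (CommGroup.torsion (Groth M)) x) ∧
    Finite (CommGroup.torsion (Groth M)) ∧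
    (∀ g₁ ∈ CommGroup.torsion (Groth M), ∀ g₂ ∈ CommGroup.torsion (Groth M),
      ∀ x y : X, IsInvertibleUnder (CommGroup.torsion (Groth M)) x →
        ActsTo g₁ x y → ActsTo g₂ x y → g₁ = g₂) := by
  have : Finite (CommGroup.torsion (Groth M)) := finite_torsion_of_commGroup_fg
  exact ⟨exists_isInvertibleUnder hinj _, this,
    fun _ _ _ _ _ _ _ h₁ h₂ => h₁.eq hfree h₂⟩

end AbelianNetworks
end

section
/- Let M be a finite commutative monoid acting faithfully and irreducibly on a nonempty set Y, let e be the minimal idempotent of M, and let X := eY. Then X is the unique nonempty subset of Y that is closed under the action of M and on which the action of M is injective. -/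
namespace AbelianNetworks

/-- The minimal idempotent of a finite commutative monoid: the product of all of its
idempotent elements. -/
noncomputable def minIdem (M : Type*) [CommMonoid M] [Fintype M] : M :=
  open scoped Classical in
  ∏ f ∈ Finset.univ.filter (fun f : M => f * f = f), f

/-- The subset `e • Y` of `Y`, where `e` is the minimal idempotent of `M`. -/
def eSet (M : Type*) (Y : Type*) [CommMonoid M] [Fintype M] [MulAction M Y] : Set Y :=
  Set.range fun y : Y => minIdem M • y

theorem exists_pow_succ_isIdempotentElem {M : Type*} [Monoid M] [Finite M] (m : M) :
    ∃ n : ℕ, IsIdempotentElem (m ^ (n + 1)) := by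
  obtain ⟨a, b, hab, h⟩ := Finite.exists_ne_map_eq_of_infinite (fun n : ℕ => m ^ n)
  wlog hlt : a < b generalizing a b
  · exact this b a hab.symm h.symm (by omega)
  obtain ⟨d, rfl⟩ := Nat.exists_eq_add_of_lt hlt
  have hstep : ∀ j : ℕ, m ^ (a + j) = m ^ (a + j + (d + 1)) := fun j => by
    have h' : m ^ a = m ^ (a + d + 1) := h
    calc m ^ (a + j) = m ^ a * m ^ j := pow_add ..
      _ = m ^ (a + d + 1) * m ^ j := by rw [← h']
      _ = m ^ (a + j + (d + 1)) := by rw [← pow_add]; congr 1; omega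
  have hper : ∀ t j : ℕ, m ^ (a + j) = m ^ (a + j + t * (d + 1)) := fun t => by
    induction t with
    | zero => simp
    | succ t ih =>
      intro j
      rw [hstep j, add_assoc a, ih]
      congr 1
      ring
  refine ⟨a * (d + 1) + d, ?_⟩
  have hexp : a * (d + 1) + d + 1 = a + (a * d + d + 1) := by ring
  rw [IsIdempotentElem, ← pow_add, hexp, hper (a + 1) (a * d + d + 1)]
  congr 1
  ring

theorem minIdem_mul_of_isIdempotentElem {M : Type*} [CommMonoid M] [Fintype M] {f : M}
    (hf : IsIdempotentElem f) : minIdem M * f = minIdem M := by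
  classical
  have hdvd : f ∣ minIdem M := Finset.dvd_prod_of_mem _ (by simpa using hf.eq)
  obtain ⟨c, hc⟩ := hdvd
  rw [hc, mul_right_comm, hf.eq]

theorem isIdempotentElem_minIdem (M : Type*) [CommMonoid M] [Fintype M] :
    IsIdempotentElem (minIdem M) := by
  classical
  rw [IsIdempotentElem, minIdem, ← Finset.prod_mul_distrib]
  exact Finset.prod_congr rfl fun f hf => (Finset.mem_filter.mp hf).2

theorem exists_mul_mul_minIdem_eq {M : Type*} [CommMonoid M] [Fintype M] (m : M) :
    ∃ n : M, n * m * minIdem M = minIdem M := by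
  obtain ⟨k, hk⟩ := exists_pow_succ_isIdempotentElem m
  exact ⟨m ^ k, by rw [← pow_succ, mul_comm, minIdem_mul_of_isIdempotentElem hk]⟩

/-- Let `M` be a finite commutative monoid acting faithfully and irreducibly on a nonempty
set `Y`, let `e` be the minimal idempotent of `M` and `X := e • Y`. Then `X` is the unique
nonempty subset of `Y` that is closed under the action of `M` and on which the action of
`M` is injective. -/
theorem eSet_unique_injective_closed_subset
    {M Y : Type*} [CommMonoid M] [Fintype M] [MulAction M Y]
    (hY : Nonempty Y)
    (hfaith : ∀ m m' : M, (∀ y : Y, m • y = m' • y) → m = m')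
    (hirr : ∀ y y' : Y, ∃ m m' : M, m • y = m' • y') :
    ((eSet M Y).Nonempty ∧
      (∀ m : M, ∀ x ∈ eSet M Y, m • x ∈ eSet M Y) ∧
      (∀ m : M, ∀ x ∈ eSet M Y, ∀ x' ∈ eSet M Y, m • x = m • x' → x = x')) ∧
    (∀ X' : Set Y, X'.Nonempty →
      (∀ m : M, ∀ x ∈ X', m • x ∈ X') →
      (∀ m : M, ∀ x ∈ X', ∀ x' ∈ X', m • x = m • x' → x = x') →
      X' = eSet M Y) := by
  have smul_minIdem : ∀ x ∈ eSet M Y, minIdem M • x = x := by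
    rintro _ ⟨y, rfl⟩
    simp only [smul_smul, (isIdempotentElem_minIdem M).eq]
  have exists_inverse : ∀ m : M, ∃ n : M, ∀ x ∈ eSet M Y, n • m • x = x := by
    intro m
    obtain ⟨n, hn⟩ := exists_mul_mul_minIdem_eq m
    refine ⟨n, ?_⟩
    rintro _ ⟨y, rfl⟩
    simp only [smul_smul, ← mul_assoc, hn]
  refine ⟨⟨Set.range_nonempty _, ?_, ?_⟩, ?_⟩
  · rintro m _ ⟨y, rfl⟩
    exact ⟨m • y, smul_comm ..⟩
  · intro m x hx x' hx' h
    obtain ⟨n, hn⟩ := exists_inverse m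
    rw [← hn x hx, h, hn x' hx']
  · rintro X' ⟨x, hx⟩ hclosed hinj
    apply Set.Subset.antisymm
    · intro z hz
      refine ⟨z, hinj (minIdem M) _ (hclosed _ z hz) z hz ?_⟩
      simp only [smul_smul, (isIdempotentElem_minIdem M).eq]
    · intro y hy
      obtain ⟨m, m', h⟩ := hirr x y
      obtain ⟨n, hn⟩ := exists_inverse m'
      rw [← hn y hy, ← h]
      exact hclosed n _ (hclosed m x hx)

end AbelianNetworks
end

section
/- (Removal lemma) Let N be an abelian network with alphabet A. For any configuration x.q, any vector n ∈ ℕ^A, and any legal execution w for x.q, the word w∖n obtained by removing n from w is a legal execution for the configuration π_n(x.q). -/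
namespace AbelianNetworks

/-- An abelian network on the alphabet `A` with state set `Q`: commuting transition maps
`t a : Q → Q` and message-passing vectors `msg a : Q → ℕ^A` satisfying the abelian axioms. -/
structure Network (A Q : Type*) where
  t : A → Q → Q
  msg : A → Q → A → ℕ
  t_comm : ∀ a b q, t a (t b q) = t b (t a q)
  msg_comm : ∀ a b q c, msg a q c + msg b (t a q) c = msg b q c + msg a (t b q) c

namespace Network

variable {A Q : Type*} [DecidableEq A] (N : Network A Q)

/-- The state obtained after processing the word `w` (letters processed left to right). -/
def tw : List A → Q → Q
  | [], q => q
  | a :: w, q => tw w (N.t a q)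

/-- The vector of messages generated while processing the word `w` from state `q`. -/
def nw : List A → Q → A → ℕ
  | [], _, _ => 0
  | a :: w, q, c => N.msg a q c + nw w (N.t a q) c

/-- The configuration transition: `π_w (x.q) = (x + N_w(q) - |w|).t_w(q)`. -/
def piW (w : List A) (c : (A → ℤ) × Q) : (A → ℤ) × Q :=
  (fun a => c.1 a + (nw N w c.2 a : ℤ) - (w.count a : ℤ), tw N w c.2)

/-- `w` is a legal execution for the configuration `c`: each executed letter has at least
one pending copy at the moment it is executed. -/
def Legal : (A → ℤ) × Q → List A → Prop
  | _, [] => True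
  | c, a :: w => 1 ≤ c.1 a ∧ Legal (piW N [a] c) w

end Network

/-- The removal `w ∖ n` of a vector `n ∈ ℕ^A` from a word `w`: delete, for each letter `a`,
the first `n a` occurrences of `a` from `w`. -/
def removeVec {A : Type*} [DecidableEq A] : List A → (A → ℕ) → List A
  | [], _ => []
  | a :: w, n =>
      if n a = 0 then a :: removeVec w n
      else removeVec w (Function.update n a (n a - 1))

namespace Network

variable {A Q : Type*} [DecidableEq A] (N : Network A Q)

theorem piW_nil (c : (A → ℤ) × Q) : N.piW [] c = c := by
  ext <;> simp [piW, nw, tw]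

theorem piW_cons (a : A) (u : List A) (c : (A → ℤ) × Q) :
    N.piW (a :: u) c = N.piW u (N.piW [a] c) := by
  refine Prod.ext (funext fun b => ?_) rfl
  simp only [piW, nw, tw, List.count_cons, List.count_nil]
  push_cast
  ring

theorem piW_singleton_comm (a b : A) (c : (A → ℤ) × Q) :
    N.piW [a] (N.piW [b] c) = N.piW [b] (N.piW [a] c) := by
  refine Prod.ext (funext fun d => ?_) (N.t_comm a b c.2)
  have h := N.msg_comm a b c.2 d
  simp only [piW, nw, tw]
  push_cast
  linarith

theorem piW_singleton_piW (a : A) (u : List A) (c : (A → ℤ) × Q) :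
    N.piW [a] (N.piW u c) = N.piW u (N.piW [a] c) := by
  induction u generalizing c with
  | nil => simp only [piW_nil]
  | cons b u ih => rw [piW_cons N b u c, ih, piW_singleton_comm, ← piW_cons]

/-- The abelian property: `π_u` depends only on the number of occurrences of each letter. -/
theorem piW_perm {u v : List A} (h : u.Perm v) (c : (A → ℤ) × Q) :
    N.piW u c = N.piW v c := by
  induction h generalizing c with
  | nil => rfl
  | cons a _ ih => rw [piW_cons, ih, ← piW_cons]
  | swap a b u =>
    rw [piW_cons N b, piW_cons N a, piW_singleton_comm, ← piW_cons, ← piW_cons]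
  | trans _ _ ih₁ ih₂ => rw [ih₁, ih₂]

end Network

/-- **Removal lemma.**  Let `N` be an abelian network.  For any configuration `c`, any
vector `n ∈ ℕ^A` (given as `n = |u|` for a word `u`, and `π_n c := π_u c`), and any legal
execution `w` for `c`, the word `w ∖ n` is a legal execution for `π_n c`. -/
theorem Network.removal {A Q : Type*} [DecidableEq A] (N : Network A Q)
    (c : (A → ℤ) × Q) (w u : List A) (hw : N.Legal c w) :
    N.Legal (N.piW u c) (removeVec w fun a => u.count a) := by
  induction w generalizing c u with
  | nil => trivial
  | cons a w ih =>
    obtain ⟨ha, hw⟩ := hw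
    by_cases hu : u.count a = 0
    · simp only [removeVec, hu, if_true]
      refine ⟨?_, ?_⟩
      · simp only [piW, hu]
        push_cast
        linarith [Int.natCast_nonneg (nw N u c.2 a)]
      · rw [piW_singleton_piW]
        exact ih _ u hw
    · have hmem : a ∈ u := List.count_pos_iff.mp (Nat.pos_of_ne_zero hu)
      have hcount : Function.update (fun b => u.count b) a (u.count a - 1) =
          fun b => (u.erase a).count b := by
        funext b
        by_cases hb : b = a
        · subst hb
          simp
        · simp [Function.update_of_ne hb, List.count_erase_of_ne hb]
      simp only [removeVec, hu, if_false]
      rw [hcount, piW_perm N (List.perm_cons_erase hmem), piW_cons]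
      exact ih _ (u.erase a) hw

end AbelianNetworks
end

section
/- Let N be a finite abelian network with alphabet A and state set Q. Then: (i) there exists a vector e ∈ ℕ^A such that t_e(q) is locally recurrent for every q ∈ Q; and (ii) if q ∈ Q and there exists n ∈ ℕ^A with n(a) ≥ 1 for all a ∈ A and t_n(q) = q, then q is locally recurrent. -/
namespace AbelianNetworks

namespace Network

variable {A Q : Type*} [DecidableEq A] (N : Network A Q)

theorem tw_single_comm (a : A) : ∀ (w : List A) (q : Q), tw N w (N.t a q) = N.t a (tw N w q)
  | [], _ => rfl
  | b :: w, q => by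
    show tw N w (N.t b (N.t a q)) = N.t a (tw N w (N.t b q))
    rw [N.t_comm b a q]
    exact tw_single_comm a w (N.t b q)

theorem tw_comm (w : List A) : ∀ (u : List A) (q : Q), tw N w (tw N u q) = tw N u (tw N w q)
  | [], _ => rfl
  | a :: u, q => by
    show tw N w (tw N u (N.t a q)) = tw N u (N.t a (tw N w q))
    rw [tw_comm w u (N.t a q)]
    exact congrArg (tw N u) (tw_single_comm N a w q)

variable [Fintype A] [Fintype Q] [DecidableEq Q]

noncomputable instance : Fintype (Function.End Q) := inferInstanceAs (Fintype (Q → Q))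

open scoped Classical in
/-- The set of idempotent elements of the transition monoid of the network `N` (the
submonoid of `End Q` generated by the maps `t a`, equivalently consisting of the maps
`t_w` for words `w`). -/
noncomputable def idemFinset : Finset (Function.End Q) :=
  Finset.univ.filter fun f => (∃ w : List A, f = fun q => tw N w q) ∧ f * f = f

open scoped Classical in
/-- The minimal idempotent of the transition monoid of the network `N`: the product of all
idempotent elements of the transition monoid. -/
noncomputable def minIdemEnd : Function.End Q :=
  (idemFinset N).noncommProd id (by
    intro f hf g hg _
    obtain ⟨w, rfl⟩ := (Finset.mem_filter.mp hf).2.1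
    obtain ⟨u, rfl⟩ := (Finset.mem_filter.mp hg).2.1
    show _ * _ = _ * _
    funext q
    exact tw_comm N w u q)

/-- A state is locally recurrent if it lies in the image `e(Q)` of the minimal idempotent
`e` of the transition monoid. -/
def LocRec (q : Q) : Prop := ∃ p : Q, minIdemEnd N p = q

end Network

namespace Network

section Words

variable {A Q : Type*} (N : Network A Q)

theorem tw_append (u v : List A) (q : Q) : tw N (u ++ v) q = tw N v (tw N u q) := by
  induction u generalizing q with
  | nil => rfl
  | cons a u ih => exact ih (N.t a q)

theorem tw_perm {u v : List A} (h : u.Perm v) (q : Q) : tw N u q = tw N v q := by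
  induction h generalizing q with
  | nil => rfl
  | cons a _ ih => exact ih (N.t a q)
  | swap a b l => exact congrArg (tw N l) (N.t_comm a b q)
  | trans _ _ ih₁ ih₂ => exact (ih₁ q).trans (ih₂ q)

theorem tw_flatten_replicate {w : List A} {q : Q} (h : tw N w q = q) (k : ℕ) :
    tw N (List.replicate k w).flatten q = q := by
  induction k with
  | zero => rfl
  | succ k ih => rw [List.replicate_succ, List.flatten_cons, tw_append, h, ih]

/-- A state fixed by a word containing every letter lies in the image of every `t_u`. -/
theorem exists_tw_eq_of_tw_eq_self [DecidableEq A] {w : List A} {q : Q}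
    (hw : ∀ a, 1 ≤ w.count a) (h : tw N w q = q) (u : List A) : ∃ p, tw N u p = q := by
  have hsub : List.Subperm u (List.replicate u.length w).flatten := by
    rw [List.subperm_iff_count]
    intro a
    rw [List.count_flatten, List.map_replicate, List.sum_replicate, smul_eq_mul]
    exact List.count_le_length.trans (Nat.le_mul_of_pos_right _ (hw a))
  obtain ⟨l, hl, hs⟩ := hsub
  obtain ⟨v, hv⟩ := hs.exists_perm_append
  refine ⟨tw N v q, ?_⟩
  rw [tw_comm, ← tw_append, ← tw_perm N (hv.trans (hl.append_right v)), tw_flatten_replicate N h]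

end Words

/-- The minimal idempotent is `t_w` for some word `w`. -/
theorem exists_minIdemEnd_eq_tw {A Q : Type*} [DecidableEq A] [Fintype A] [Fintype Q]
    [DecidableEq Q] (N : Network A Q) : ∃ w : List A, minIdemEnd N = fun q => tw N w q := by
  classical
  unfold minIdemEnd
  refine Finset.noncommProd_induction _ _ _
    (fun f : Function.End Q => ∃ w : List A, f = fun q => tw N w q) ?_ ⟨[], rfl⟩ ?_
  · rintro _ _ ⟨u, rfl⟩ ⟨v, rfl⟩
    exact ⟨v ++ u, funext fun q => (tw_append N v u q).symm⟩
  · intro f hf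
    exact (Finset.mem_filter.mp hf).2.1

end Network

/-- Let `N` be a finite abelian network.  Then (i) there is a vector `e ∈ ℕ^A` such that
`t_e q` is locally recurrent for every state `q` (here `t_n := t_w` for any word `w` with
`|w| = n`); and (ii) any state `q` with `t_n q = q` for some vector `n ≥ 1` (i.e. some word
`w` with `|w| ≥ 1` coordinatewise and `t_w q = q`) is locally recurrent. -/
theorem Network.exists_idempotent_vector_and_locally_recurrent_criterion
    {A Q : Type*} [DecidableEq A] [Fintype A] [Fintype Q] [DecidableEq Q]
    (N : Network A Q) :
    (∃ n : A → ℕ, ∀ w : List A, (∀ a, w.count a = n a) → ∀ q : Q, N.LocRec (N.tw w q)) ∧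
    (∀ q : Q, (∃ w : List A, (∀ a, 1 ≤ w.count a) ∧ N.tw w q = q) → N.LocRec q) := by
  obtain ⟨u, hu⟩ := N.exists_minIdemEnd_eq_tw
  refine ⟨⟨fun a => u.count a, fun w hw q => ⟨q, ?_⟩⟩, ?_⟩
  · rw [hu]
    exact N.tw_perm (List.perm_iff_count.mpr fun a => (hw a).symm) q
  · rintro q ⟨w, hw, h⟩
    obtain ⟨p, hp⟩ := N.exists_tw_eq_of_tw_eq_self hw h u
    exact ⟨p, by rw [hu]; exact hp⟩

end AbelianNetworks
end

section
/- Let N be a finite abelian network with alphabet A and state set Q, and let Loc(N) be its set of locally recurrent states. Then for every n ∈ ℕ^A: (i) the map t_n restricted to Loc(N) is a bijection from Loc(N) to Loc(N); and (ii) the map π_n restricted to ℤ^A × Loc(N) is a bijection from ℤ^A × Loc(N) to ℤ^A × Loc(N). -/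
namespace AbelianNetworks

namespace Network

section Words

variable {A Q : Type*} (N : Network A Q)

/-- The maps `t_w` are closed under powers. -/
theorem exists_tw_eq_pow (w : List A) (k : ℕ) :
    ∃ u : List A, (show Function.End Q from tw N w) ^ k = tw N u := by
  induction k with
  | zero => exact ⟨[], rfl⟩
  | succ k ih =>
    obtain ⟨u, hu⟩ := ih
    refine ⟨w ++ u, ?_⟩
    rw [pow_succ, hu]
    funext q
    exact (tw_append N w u q).symm

/-- A configuration map is bijective on the configurations whose state lies in a set on which
the underlying state map is bijective. -/
theorem bijOn_piW [DecidableEq A] (w : List A) {S : Set Q} (h : Set.BijOn (fun q => N.tw w q) S S) :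
    Set.BijOn (fun c => N.piW w c) {c : (A → ℤ) × Q | c.2 ∈ S}
      {c : (A → ℤ) × Q | c.2 ∈ S} := by
  refine ⟨fun c hc => h.mapsTo hc, ?_, ?_⟩
  · rintro ⟨x, p⟩ hp ⟨y, q⟩ hq hxy
    obtain ⟨h₁, h₂⟩ := Prod.ext_iff.mp hxy
    obtain rfl : p = q := h.injOn hp hq h₂
    refine Prod.ext (funext fun a => ?_) rfl
    have := congrFun h₁ a
    simp only [piW] at this
    exact add_right_cancel (sub_left_injective this)
  · rintro ⟨y, q⟩ hq
    obtain ⟨p, hp, rfl⟩ := h.surjOn hq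
    refine ⟨(fun a => y a - (nw N w p a : ℤ) + (w.count a : ℤ), p), hp, ?_⟩
    refine Prod.ext (funext fun a => ?_) rfl
    simp only [piW]
    ring

end Words

/-- Every element of a finite monoid has an idempotent positive power. -/
theorem exists_isIdempotentElem_pow {M : Type*} [Monoid M] [Finite M] (x : M) :
    ∃ k, IsIdempotentElem (x ^ (k + 1)) := by
  obtain ⟨i, j, hij, h⟩ := Finite.exists_ne_map_eq_of_infinite (fun n : ℕ => x ^ n)
  wlog hlt : i < j generalizing i j
  · exact this j i hij.symm h.symm (by omega)
  obtain ⟨d, rfl⟩ := Nat.exists_eq_add_of_lt hlt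
  have period : ∀ m n : ℕ, x ^ (i + n + m * (d + 1)) = x ^ (i + n) := by
    intro m n
    induction m with
    | zero => simp
    | succ m ih =>
      rw [← ih, show i + n + (m + 1) * (d + 1) = (i + d + 1) + (n + m * (d + 1)) by ring,
        pow_add, ← show x ^ i = x ^ (i + d + 1) from h, ← pow_add]
      congr 1
      ring
  refine ⟨i + (i + 1) * d, ?_⟩
  have key := period (i + 1) ((i + 1) * d + 1)
  rw [IsIdempotentElem, ← pow_add]
  convert key using 2 <;> ring

section Recurrent

variable {A Q : Type*} [DecidableEq A] [Fintype Q] [DecidableEq Q]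
  (N : Network A Q)

theorem exists_minIdemEnd_eq_tw_s14 : ∃ u : List A, minIdemEnd N = tw N u := by
  classical
  refine Finset.noncommProd_induction (idemFinset N) id _
    (fun f : Function.End Q => ∃ u : List A, f = tw N u) ?_ ⟨[], rfl⟩ ?_
  · rintro f g ⟨u, rfl⟩ ⟨v, rfl⟩
    refine ⟨v ++ u, ?_⟩
    funext q
    exact (tw_append N v u q).symm
  · intro f hf
    exact (Finset.mem_filter.mp hf).2.1

theorem mul_minIdemEnd {f : Function.End Q} (hf : f ∈ idemFinset N) :
    f * minIdemEnd N = minIdemEnd N := by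
  classical
  have hff : f * f = f := (Finset.mem_filter.mp hf).2.2
  have absorb (comm) :
      f * (idemFinset N).noncommProd id comm = (idemFinset N).noncommProd id comm := by
    rw [← Finset.mul_noncommProd_erase _ hf, id, ← mul_assoc, hff]
  exact absorb _

theorem LocRec.map_tw {N : Network A Q} {q : Q} (hq : N.LocRec q) (w : List A) :
    N.LocRec (N.tw w q) := by
  obtain ⟨p, rfl⟩ := hq
  obtain ⟨u, hu⟩ := exists_minIdemEnd_eq_tw_s14 N
  rw [hu]
  exact ⟨N.tw w p, by rw [hu]; exact tw_comm N u w p⟩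

/-- The action of a word on the locally recurrent states is inverted by another word. -/
theorem exists_tw_inverse (w : List A) :
    ∃ v : List A, ∀ q, N.LocRec q → N.tw v (N.tw w q) = q := by
  obtain ⟨k, hk⟩ := exists_isIdempotentElem_pow (show Function.End Q from tw N w)
  obtain ⟨u, hu⟩ := exists_tw_eq_pow N w (k + 1)
  obtain ⟨v, hv⟩ := exists_tw_eq_pow N w k
  have hmem : (show Function.End Q from tw N w) ^ (k + 1) ∈ idemFinset N := by
    classical
    exact Finset.mem_filter.mpr ⟨Finset.mem_univ _, ⟨u, hu⟩, hk⟩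
  have hfix := mul_minIdemEnd N hmem
  rw [pow_succ, hv] at hfix
  refine ⟨v, ?_⟩
  rintro _ ⟨p, rfl⟩
  exact congrFun hfix p

theorem bijOn_tw (w : List A) :
    Set.BijOn (fun q => N.tw w q) {q : Q | N.LocRec q} {q : Q | N.LocRec q} := by
  obtain ⟨v, hv⟩ := exists_tw_inverse N w
  refine ⟨fun q hq => LocRec.map_tw hq w, ?_, ?_⟩
  · intro p hp q hq h
    rw [← hv p hp, ← hv q hq]
    exact congrArg (N.tw v) h
  · intro q hq
    exact ⟨N.tw v q, LocRec.map_tw hq v, (tw_comm N w v q).trans (hv q hq)⟩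

end Recurrent

end Network

/-- Let `N` be a finite abelian network with set `Loc(N)` of locally recurrent states.
Then for every `n ∈ ℕ^A` (represented by any word `w` with `|w| = n`): (i) `t_n` restricted
to `Loc(N)` is a bijection from `Loc(N)` to `Loc(N)`; and (ii) `π_n` restricted to
`ℤ^A × Loc(N)` is a bijection from `ℤ^A × Loc(N)` to `ℤ^A × Loc(N)`. -/
theorem Network.locally_recurrent_bijections
    {A Q : Type*} [DecidableEq A] [Fintype A] [Fintype Q] [DecidableEq Q]
    (N : Network A Q) (w : List A) :
    Set.BijOn (fun q => N.tw w q) {q : Q | N.LocRec q} {q : Q | N.LocRec q} ∧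
    Set.BijOn (fun c => N.piW w c)
      {c : (A → ℤ) × Q | N.LocRec c.2} {c : (A → ℤ) × Q | N.LocRec c.2} :=
  ⟨Network.bijOn_tw N w, Network.bijOn_piW N w (Network.bijOn_tw N w)⟩

end AbelianNetworks
end

section
/- Let N be an abelian network with alphabet A, let R ⊆ A, and let N_R be the thief network of N restricted to R. Then: (i) if w ∈ A* is a legal execution for the configuration x.q in N_R, then w is a legal execution for x.q in N; and (ii) if w ∈ A* is a legal execution for x.q in N, then w is a legal execution for the configuration (x_R + |w|_{A∖R}).q in N_R, where for z ∈ ℤ^A and S ⊆ A, z_S denotes the vector agreeing with z on S and equal to 0 off S. -/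
namespace AbelianNetworks

/-- The thief network `N_R` based on `N`, with messages restricted to `R ⊆ A`: same alphabet,
states and transition maps as `N`, but every message-passing letter outside `R` is discarded. -/
def Network.thief {A Q : Type*} (N : Network A Q) (R : Set A) [DecidablePred (· ∈ R)] :
    Network A Q where
  t := N.t
  msg := fun a q b => if b ∈ R then N.msg a q b else 0
  t_comm := N.t_comm
  msg_comm := by
    intro a b q c
    by_cases hc : c ∈ R
    · simp only [hc, if_true]
      exact N.msg_comm a b q c
    · simp only [hc, if_false]

namespace Network

variable {A Q : Type*} [DecidableEq A] (N : Network A Q)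

theorem legal_cons {x : A → ℤ} {q : Q} {a : A} {w : List A} :
    N.Legal (x, q) (a :: w) ↔ 1 ≤ x a ∧
      N.Legal (fun b => x b + (N.msg a q b : ℤ) - ([a].count b : ℤ), N.t a q) w :=
  Iff.rfl

variable (R : Set A) [DecidablePred (· ∈ R)]

/-- A legal execution in the thief network stays legal in the original network when letters
are added to the initial configuration. -/
theorem legal_of_thief_legal {w : List A} {x y : A → ℤ} {q : Q} (hxy : ∀ b, x b ≤ y b)
    (h : (N.thief R).Legal (x, q) w) : N.Legal (y, q) w := by
  induction w generalizing x y q with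
  | nil => trivial
  | cons a w ih =>
    rw [legal_cons] at h ⊢
    refine ⟨h.1.trans (hxy a), ih (fun b => ?_) h.2⟩
    have := hxy b
    simp only [thief]
    split_ifs <;> push_cast <;> omega

/-- A legal execution `w` in a network is legal in the thief network for every configuration
that has at least as many letters in `R`, and at least `|w|` letters outside `R`. -/
theorem thief_legal_of_legal {w : List A} {x y : A → ℤ} {q : Q} (hR : ∀ b ∈ R, x b ≤ y b)
    (hw : ∀ b ∉ R, (w.count b : ℤ) ≤ y b) (h : N.Legal (x, q) w) :
    (N.thief R).Legal (y, q) w := by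
  induction w generalizing x y q with
  | nil => trivial
  | cons a w ih =>
    rw [legal_cons] at h ⊢
    refine ⟨?_, ih (fun b hb => ?_) (fun b hb => ?_) h.2⟩
    · by_cases ha : a ∈ R
      · exact h.1.trans (hR a ha)
      · have := hw a ha
        rw [List.count_cons_self] at this
        omega
    · have := hR b hb
      simp only [thief, if_pos hb]
      omega
    · have := hw b hb
      rw [List.count_cons] at this
      simp only [thief, if_neg hb, List.count_singleton]
      push_cast at this ⊢
      omega

end Network

/-- Let `N` be an abelian network, `R ⊆ A`, and `N_R` the thief network of `N` restricted
to `R`.  Then (i) any legal execution for a configuration `x.q` in `N_R` is a legal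
execution for `x.q` in `N`; and (ii) any legal execution `w` for `x.q` in `N` is a legal
execution in `N_R` for the configuration `(x_R + |w|_{A∖R}).q`. -/
theorem Network.thief_legal {A Q : Type*} [DecidableEq A] (N : Network A Q)
    (R : Set A) [DecidablePred (· ∈ R)] :
    (∀ (c : (A → ℤ) × Q) (w : List A), (N.thief R).Legal c w → N.Legal c w) ∧
    (∀ (x : A → ℤ) (q : Q) (w : List A), N.Legal (x, q) w →
      (N.thief R).Legal (fun a => if a ∈ R then x a else (w.count a : ℤ), q) w) := by
  refine ⟨fun _ _ h => N.legal_of_thief_legal R (fun _ => le_rfl) h, fun x q w h =>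
    N.thief_legal_of_legal R (fun b hb => ?_) (fun b hb => ?_) h⟩
  · rw [if_pos hb]
  · rw [if_neg hb]

end AbelianNetworks
end
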